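/- arXiv:1907.06816 — 4 statements merged into one kernel-verified Lean document; each statement's English description precedes it below -/
import Mathlib

section
/- Let n ≥ 3 and let p, q ≥ 0 satisfy (n-2)q + (n-1)p > n. Then there exist constants β > 0 and c > 0 such that the function u(x) = c(1 + |x|²)^{-β} is a positive, nonconstant, bounded C² function on ℝ^n satisfying -Δu(x) ≥ u(x)^q |∇u(x)|^p for every x ∈ ℝ^n. -/
/-- The Laplacian of `u : ℝⁿ → ℝ` at `x`, defined as the sum of the pure second
partial derivatives in the coordinate directions. -/
noncomputable def lap {n : ℕ} (u : EuclideanSpace ℝ (Fin n) → ℝ)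
    (x : EuclideanSpace ℝ (Fin n)) : ℝ :=
  ∑ i : Fin n,
    fderiv ℝ (fun y => fderiv ℝ u y (EuclideanSpace.single i (1 : ℝ))) x
      (EuclideanSpace.single i (1 : ℝ))

/-- The derivative of `x ↦ (1 + ‖x‖²)^a` at `x` is `2a (1 + ‖x‖²)^(a-1) ⟪x, ·⟫`. -/
theorem hasFDerivAt_one_add_norm_sq_rpow {E : Type*} [NormedAddCommGroup E]
    [InnerProductSpace ℝ E] (a : ℝ) (x : E) :
    HasFDerivAt (fun y : E => (1 + ‖y‖ ^ 2) ^ a)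
      ((2 * a * (1 + ‖x‖ ^ 2) ^ (a - 1)) • innerSL ℝ x) x := by
  have h := ((hasStrictFDerivAt_norm_sq x).hasFDerivAt.const_add 1).rpow_const (p := a)
    (Or.inl (by positivity))
  refine h.congr_fderiv ?_
  ext v
  simp
  ring

/-- The gradient of `x ↦ c (1 + ‖x‖²)^a`. -/
theorem gradient_const_mul_one_add_norm_sq_rpow {E : Type*} [NormedAddCommGroup E]
    [InnerProductSpace ℝ E] [CompleteSpace E] (c a : ℝ) (x : E) :
    gradient (fun y : E => c * (1 + ‖y‖ ^ 2) ^ a) x =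
      (2 * a * c * (1 + ‖x‖ ^ 2) ^ (a - 1)) • x := by
  refine HasGradientAt.gradient ?_
  rw [hasGradientAt_iff_hasFDerivAt]
  refine ((hasFDerivAt_one_add_norm_sq_rpow a x).const_mul c).congr_fderiv ?_
  ext v
  simp
  ring

/-- The Laplacian of `x ↦ c (1 + ‖x‖²)^a`. -/
theorem lap_const_mul_one_add_norm_sq_rpow {n : ℕ} (c a : ℝ) (x : EuclideanSpace ℝ (Fin n)) :
    lap (fun y => c * (1 + ‖y‖ ^ 2) ^ a) x =
      2 * a * c * (n * (1 + ‖x‖ ^ 2) ^ (a - 1) +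
        2 * (a - 1) * (1 + ‖x‖ ^ 2) ^ (a - 2) * ‖x‖ ^ 2) := by
  have first (i : Fin n) : (fun y : EuclideanSpace ℝ (Fin n) =>
      fderiv ℝ (fun y => c * (1 + ‖y‖ ^ 2) ^ a) y (EuclideanSpace.single i (1 : ℝ))) =
      fun y => (2 * a * c) * ((1 + ‖y‖ ^ 2) ^ (a - 1) * y i) := by
    funext y
    rw [((hasFDerivAt_one_add_norm_sq_rpow a y).const_mul c).fderiv]
    simp [EuclideanSpace.inner_single_right]
    ring
  have second (i : Fin n) : fderiv ℝ (fun y : EuclideanSpace ℝ (Fin n) =>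
        (2 * a * c) * ((1 + ‖y‖ ^ 2) ^ (a - 1) * y i)) x (EuclideanSpace.single i (1 : ℝ)) =
      2 * a * c * ((1 + ‖x‖ ^ 2) ^ (a - 1) +
        2 * (a - 1) * (1 + ‖x‖ ^ 2) ^ (a - 2) * x i ^ 2) := by
    have hcoord : HasFDerivAt (fun y : EuclideanSpace ℝ (Fin n) => y i)
        (EuclideanSpace.proj i : EuclideanSpace ℝ (Fin n) →L[ℝ] ℝ) x :=
      (EuclideanSpace.proj i : EuclideanSpace ℝ (Fin n) →L[ℝ] ℝ).hasFDerivAt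
    have h := ((hasFDerivAt_one_add_norm_sq_rpow (a - 1) x).fun_mul hcoord).const_mul (2 * a * c)
    rw [h.fderiv, show a - 1 - 1 = a - 2 by ring]
    simp [EuclideanSpace.inner_single_right]
    ring
  simp only [lap, first, second]
  rw [← Finset.mul_sum, Finset.sum_add_distrib, ← Finset.mul_sum,
    EuclideanSpace.real_norm_sq_eq x]
  simp

/-- There is an exponent `β` below `(n - 2) / 2` for which `(1 + |x|²)^{-β}` decays fast enough. -/
theorem exists_supersolution_exponent {N p q : ℝ} (hN : 2 < N) (hpq1 : 1 < p + q)
    (hpq : N < (N - 2) * q + (N - 1) * p) :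
    ∃ β : ℝ, 0 < β ∧ 2 * β < N - 2 ∧ β + 1 ≤ β * q + (β + 1) * p - p / 2 := by
  have hd : 0 < p + q - 1 := by linarith
  refine ⟨max ((N - 2) / 4) ((1 - p / 2) / (p + q - 1)),
    lt_max_of_lt_left (by linarith), ?_, ?_⟩
  · have : max ((N - 2) / 4) ((1 - p / 2) / (p + q - 1)) < (N - 2) / 2 := by
      refine max_lt (by linarith) ?_
      rw [div_lt_iff₀ hd]
      linarith
    linarith
  · have := (div_le_iff₀ hd).1 (le_max_right ((N - 2) / 4) ((1 - p / 2) / (p + q - 1)))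
    linarith

/-- A positive amplitude `c` with `c^r A = c K`, when `r > 1`. -/
theorem exists_amplitude {r A K : ℝ} (hr : 1 < r) (hA : 0 < A) (hK : 0 < K) :
    ∃ c : ℝ, 0 < c ∧ c ^ r * A = c * K := by
  have hc : 0 < (K / A) ^ (r - 1)⁻¹ := by positivity
  refine ⟨_, hc, ?_⟩
  have h : ((K / A) ^ (r - 1)⁻¹) ^ (r - 1) = K / A :=
    Real.rpow_inv_rpow (by positivity) (by linarith)
  rw [Real.rpow_sub_one hc.ne', div_eq_div_iff hc.ne' hA.ne'] at h
  rw [h, mul_comm]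

/-- **Nonconstant bounded supersolutions exist** (Remark 1.1(a)): if `n ≥ 3` and
`(n-2)q + (n-1)p > n` with `p, q ≥ 0`, then for suitable `β, c > 0` the function
`u(x) = c(1 + |x|²)^{-β}` is a positive, nonconstant, bounded `C²` supersolution of
`-Δu ≥ u^q |∇u|^p` on `ℝⁿ`. -/
theorem exists_nonconstant_supersolution {n : ℕ} (hn : 3 ≤ n) {p q : ℝ}
    (hp : 0 ≤ p) (hq : 0 ≤ q)
    (hpq : (n : ℝ) < ((n : ℝ) - 2) * q + ((n : ℝ) - 1) * p) :
    ∃ β : ℝ, 0 < β ∧ ∃ c : ℝ, 0 < c ∧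
      (fun u : EuclideanSpace ℝ (Fin n) → ℝ =>
        (∀ x, 0 < u x) ∧ (∃ x y, u x ≠ u y) ∧ (∃ M : ℝ, ∀ x, u x ≤ M) ∧
          ContDiff ℝ 2 u ∧
          ∀ x, u x ^ q * ‖gradient u x‖ ^ p ≤ -lap u x)
        (fun x => c * (1 + ‖x‖ ^ 2) ^ (-β)) := by
  have hn' : (3 : ℝ) ≤ n := by exact_mod_cast hn
  have hpq1 : 1 < p + q := by nlinarith
  obtain ⟨β, hβ, hβn, hβpq⟩ :=
    exists_supersolution_exponent (by linarith : (2 : ℝ) < n) hpq1 hpq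
  obtain ⟨c, hc, hcK⟩ := exists_amplitude (A := (2 * β) ^ p) (K := 2 * β * (n - 2 - 2 * β))
    hpq1 (by positivity) (mul_pos (by positivity) (by linarith))
  refine ⟨β, hβ, c, hc, fun x => by positivity, ?_, ⟨c, fun x => ?_⟩, ?_, fun x => ?_⟩
  · refine ⟨0, EuclideanSpace.single ⟨0, by omega⟩ 1, ?_⟩
    have h : (2 : ℝ) ^ (-β) < 1 := Real.rpow_lt_one_of_one_lt_of_neg (by norm_num) (by linarith)
    norm_num
    exact (mul_lt_of_lt_one_right hc h).ne'
  · refine mul_le_of_le_one_right hc.le (Real.rpow_le_one_of_one_le_of_nonpos ?_ (by linarith))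
    nlinarith [sq_nonneg ‖x‖]
  · exact contDiff_const.mul ((contDiff_const.add (contDiff_norm_sq ℝ)).rpow_const_of_ne
      fun x => by positivity)
  · rw [gradient_const_mul_one_add_norm_sq_rpow, lap_const_mul_one_add_norm_sq_rpow, norm_smul]
    have hsx : ‖x‖ ^ 2 = (1 + ‖x‖ ^ 2) - 1 := by ring
    have hs1 : 1 ≤ 1 + ‖x‖ ^ 2 := by nlinarith [sq_nonneg ‖x‖]
    have hxs : ‖x‖ ≤ (1 + ‖x‖ ^ 2) ^ (1 / 2 : ℝ) := by
      rw [← Real.sqrt_eq_rpow]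
      exact Real.le_sqrt_of_sq_le (by linarith)
    set s := 1 + ‖x‖ ^ 2
    have hs : 0 < s := by linarith
    have hnorm : ‖2 * -β * c * s ^ (-β - 1)‖ = 2 * β * c * s ^ (-β - 1) := by
      rw [show 2 * -β * c * s ^ (-β - 1) = -(2 * β * c * s ^ (-β - 1)) by ring, norm_neg,
        Real.norm_of_nonneg (by positivity)]
    have hstep : s ^ (-β - 1) = s ^ (-β - 2) * s := by
      rw [← Real.rpow_add_one hs.ne']
      congr 1
      ring
    rw [hnorm]
    calc (c * s ^ (-β)) ^ q * (2 * β * c * s ^ (-β - 1) * ‖x‖) ^ p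
        ≤ (c * s ^ (-β)) ^ q * (2 * β * c * s ^ (-β - 1) * s ^ (1 / 2 : ℝ)) ^ p := by gcongr
      _ = c ^ (p + q) * (2 * β) ^ p * s ^ (-(β * q + (β + 1) * p - p / 2)) := by
          rw [mul_assoc (2 * β * c), ← Real.rpow_add hs, Real.mul_rpow hc.le (by positivity),
            Real.mul_rpow (by positivity) (by positivity), Real.mul_rpow (by positivity) hc.le,
            ← Real.rpow_mul hs.le, ← Real.rpow_mul hs.le, Real.rpow_add hc,
            show -(β * q + (β + 1) * p - p / 2) = -β * q + (-β - 1 + 1 / 2) * p by ring,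
            Real.rpow_add hs]
          ring
      _ ≤ c ^ (p + q) * (2 * β) ^ p * s ^ (-β - 1) := by
          gcongr
          linarith
      _ = 2 * β * c * (s ^ (-β - 2) * ((n - 2 - 2 * β) * s)) := by
          rw [hcK, hstep]
          ring
      _ ≤ 2 * β * c * (s ^ (-β - 2) * (n * s - 2 * (β + 1) * (s - 1))) := by
          gcongr
          linarith
      _ = _ := by
          rw [hsx, hstep]
          ring
end

section
/- Let n ≥ 1 and let q₁, q₂, r₁, r₂ ≥ 0. Let (u, v) be a pair of nonnegative, bounded, twice continuously differentiable functions on ℝ^n satisfying -Δu = u^{q₁} v^{r₁} |∇u|² and -Δv = v^{q₂} u^{r₂} |∇v|² pointwise on ℝ^n. Then u and v are constant. -/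
open MeasureTheory

/-- The truncated paraboloid `(1 - ‖z‖²)₊`, used as the weight of a radial mean. -/
noncomputable def paraboloid {E : Type*} [NormedAddCommGroup E] (z : E) : ℝ :=
  max (1 - ‖z‖ ^ 2) 0

section Paraboloid

variable {E : Type*} [NormedAddCommGroup E]

lemma paraboloid_nonneg (z : E) : 0 ≤ paraboloid z := le_max_right _ _

lemma paraboloid_le_one (z : E) : paraboloid z ≤ 1 :=
  max_le (by nlinarith [sq_nonneg ‖z‖]) zero_le_one

lemma paraboloid_eq_zero {z : E} (hz : 1 ≤ ‖z‖) : paraboloid z = 0 :=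
  max_eq_right (by nlinarith)

lemma continuous_paraboloid : Continuous (paraboloid : E → ℝ) := by
  unfold paraboloid
  fun_prop

lemma hasCompactSupport_paraboloid [ProperSpace E] :
    HasCompactSupport (paraboloid : E → ℝ) := by
  refine HasCompactSupport.intro (isCompact_closedBall (0 : E) 1) fun z hz => ?_
  refine paraboloid_eq_zero ?_
  simp only [Metric.mem_closedBall, dist_zero_right, not_le] at hz
  exact hz.le

lemma integral_paraboloid_pos [ProperSpace E] [MeasurableSpace E] [BorelSpace E]
    (μ : Measure E) [μ.IsOpenPosMeasure] [IsFiniteMeasureOnCompacts μ] :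
    0 < ∫ z, paraboloid z ∂μ :=
  continuous_paraboloid.integral_pos_of_hasCompactSupport_nonneg_nonzero
    hasCompactSupport_paraboloid paraboloid_nonneg (x := 0) (by simp [paraboloid])

lemma hasDerivAt_max_zero_sq (t : ℝ) :
    HasDerivAt (fun s : ℝ => max s 0 ^ 2) (2 * max t 0) t := by
  rcases lt_trichotomy t 0 with ht | rfl | ht
  · rw [max_eq_right ht.le, mul_zero]
    refine (hasDerivAt_const t (0 : ℝ)).congr_of_eventuallyEq ?_
    filter_upwards [eventually_lt_nhds ht] with s hs
    simp [max_eq_right hs.le]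
  · rw [hasDerivAt_iff_isLittleO]
    have h : (fun s : ℝ => s ^ 2) =o[nhds 0] fun s : ℝ => s := by
      simpa using Asymptotics.isLittleO_pow_pow (𝕜 := ℝ) (m := 1) (n := 2) one_lt_two
    refine ((Asymptotics.IsBigO.of_norm_le fun s => ?_).trans_isLittleO h).congr_right
      (by simp)
    rcases le_total s 0 with hs | hs <;> simp [hs, sq_nonneg]
  · rw [max_eq_left ht.le]
    refine (by simpa using hasDerivAt_pow 2 t : HasDerivAt (fun s : ℝ => s ^ 2) (2 * t) t)
      |>.congr_of_eventuallyEq ?_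
    filter_upwards [eventually_gt_nhds ht] with s hs
    simp [max_eq_left hs.le]

lemma hasFDerivAt_paraboloid_sq {E : Type*} [NormedAddCommGroup E] [InnerProductSpace ℝ E]
    (z : E) :
    HasFDerivAt (fun z : E => paraboloid z ^ 2) (-(4 * paraboloid z) • innerSL ℝ z) z := by
  have h := (hasDerivAt_max_zero_sq (1 - ‖z‖ ^ 2)).comp_hasFDerivAt z
    ((hasStrictFDerivAt_norm_sq z).hasFDerivAt.const_sub 1)
  refine h.congr_fderiv ?_
  ext w
  simp only [paraboloid, smul_apply, neg_apply, smul_eq_mul, nsmul_eq_mul]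
  push_cast
  ring

end Paraboloid

section Mean

variable {n : ℕ} {f : EuclideanSpace ℝ (Fin n) → ℝ}

local notation "𝔼" => EuclideanSpace ℝ (Fin n)

lemma integrable_mul_paraboloid {g : 𝔼 → ℝ} (hg : Continuous g) :
    Integrable fun z => g z * paraboloid z :=
  (hg.mul continuous_paraboloid).integrable_of_hasCompactSupport
    hasCompactSupport_paraboloid.mul_left

lemma integrable_mul_paraboloid_sq {g : 𝔼 → ℝ} (hg : Continuous g) :
    Integrable fun z => g z * paraboloid z ^ 2 := by
  simpa only [Pi.mul_apply, mul_assoc, pow_two] using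
    integrable_mul_paraboloid (hg.mul continuous_paraboloid)

lemma contDiff_fderiv_apply (hf : ContDiff ℝ 2 f) (e : 𝔼) :
    ContDiff ℝ 1 fun y => fderiv ℝ f y e :=
  (hf.fderiv_right (m := 1) (by norm_num)).clm_apply contDiff_const

/-- Integration by parts against the paraboloid weight. -/
lemma integral_mul_inner_paraboloid {g : 𝔼 → ℝ} (hg : ContDiff ℝ 1 g) (x e : 𝔼) (R : ℝ) :
    ∫ z, g (x + R • z) * (inner ℝ z e * paraboloid z)
      = R / 4 * ∫ z, fderiv ℝ g (x + R • z) e * paraboloid z ^ 2 := by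
  have hgR (z : 𝔼) : HasFDerivAt (fun z : 𝔼 => g (x + R • z))
      ((fderiv ℝ g (x + R • z)).comp (R • ContinuousLinearMap.id ℝ 𝔼)) z :=
    ((hg.differentiable (by norm_num)) (x + R • z)).hasFDerivAt.comp z
      (((hasFDerivAt_id z).const_smul R).const_add x)
  have hcont : Continuous fun z : 𝔼 => g (x + R • z) := hg.continuous.comp (by fun_prop)
  have hcont' : Continuous fun z : 𝔼 => fderiv ℝ g (x + R • z) e :=
    ((hg.continuous_fderiv (by norm_num)).comp (by fun_prop :
      Continuous fun z : 𝔼 => x + R • z)).clm_apply continuous_const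
  have h1 (z : 𝔼) : fderiv ℝ (fun z : 𝔼 => paraboloid z ^ 2) z e
      = -4 * (inner ℝ z e * paraboloid z) := by
    rw [(hasFDerivAt_paraboloid_sq z).fderiv]
    simp
    ring
  have h2 (z : 𝔼) : fderiv ℝ (fun z : 𝔼 => g (x + R • z)) z e
      = R * fderiv ℝ g (x + R • z) e := by
    rw [(hgR z).fderiv]
    simp
  have key := integral_mul_fderiv_eq_neg_fderiv_mul_of_integrable (μ := volume)
    (f := fun z : 𝔼 => g (x + R • z)) (g := fun z : 𝔼 => paraboloid z ^ 2) (v := e)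
    (by
      simp_rw [h2]
      exact integrable_mul_paraboloid_sq (continuous_const.mul hcont'))
    (by
      simp_rw [h1]
      convert integrable_mul_paraboloid (g := fun z : 𝔼 => -4 * g (x + R • z) * inner ℝ z e)
        (by fun_prop) using 2
      ring)
    (integrable_mul_paraboloid_sq hcont)
    (fun z _ => (hgR z).differentiableAt)
    (fun z _ => (hasFDerivAt_paraboloid_sq z).differentiableAt)
  simp_rw [h1, h2, mul_assoc, mul_left_comm _ (-4 : ℝ), integral_const_mul] at key
  linarith

lemma hasDerivAt_paraboloidMean (hf : ContDiff ℝ 2 f) (x : 𝔼) (R : ℝ) :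
    HasDerivAt (fun R : ℝ => ∫ z, f (x + R • z) * paraboloid z)
      (∫ z, fderiv ℝ f (x + R • z) z * paraboloid z) R := by
  have hf' : Continuous (fderiv ℝ f) := hf.continuous_fderiv (by norm_num)
  have hD : Continuous fun p : ℝ × 𝔼 => fderiv ℝ f (x + p.1 • p.2) p.2 :=
    (hf'.comp (by fun_prop : Continuous fun p : ℝ × 𝔼 => x + p.1 • p.2)).clm_apply
      continuous_snd
  obtain ⟨C, hC⟩ := ((isCompact_closedBall R 1).prod
    (isCompact_closedBall (0 : 𝔼) 1)).exists_bound_of_continuousOn hD.continuousOn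
  refine (hasDerivAt_integral_of_dominated_loc_of_deriv_le
    (bound := fun z : 𝔼 => C * paraboloid z) (F := fun R z => f (x + R • z) * paraboloid z)
    (F' := fun R z => fderiv ℝ f (x + R • z) z * paraboloid z)
    (Metric.closedBall_mem_nhds R one_pos) ?_ ?_ ?_ ?_ ?_ ?_).2
  · refine Filter.Eventually.of_forall fun r => ?_
    exact (integrable_mul_paraboloid (hf.continuous.comp (by fun_prop))).aestronglyMeasurable
  · exact integrable_mul_paraboloid (hf.continuous.comp (by fun_prop))
  · exact (integrable_mul_paraboloid
      (hD.comp (by fun_prop : Continuous fun z : 𝔼 => (R, z)))).aestronglyMeasurable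
  · refine Filter.Eventually.of_forall fun z r hr => ?_
    rw [norm_mul, Real.norm_of_nonneg (paraboloid_nonneg z)]
    rcases le_total ‖z‖ 1 with hz | hz
    · exact mul_le_mul_of_nonneg_right (hC (r, z) ⟨hr, by simpa using hz⟩)
        (paraboloid_nonneg z)
    · simp [paraboloid_eq_zero hz]
  · exact integrable_mul_paraboloid continuous_const
  · refine Filter.Eventually.of_forall fun z r _ => ?_
    have h1 : HasDerivAt (fun r : ℝ => x + r • z) z r := by
      simpa using ((hasDerivAt_id r).smul_const z).const_add x
    exact (((hf.differentiable (by norm_num)) (x + r • z)).hasFDerivAt.comp_hasDerivAt r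
      h1).mul_const _

lemma integral_fderiv_mul_paraboloid (hf : ContDiff ℝ 2 f) (x : 𝔼) (R : ℝ) :
    ∫ z, fderiv ℝ f (x + R • z) z * paraboloid z
      = R / 4 * ∫ z, lap f (x + R • z) * paraboloid z ^ 2 := by
  have hexp (z : 𝔼) : fderiv ℝ f (x + R • z) z * paraboloid z
      = ∑ i, fderiv ℝ f (x + R • z) (EuclideanSpace.single i 1)
          * (inner ℝ z (EuclideanSpace.single i (1 : ℝ)) * paraboloid z) := by
    have hz : z = ∑ i, z i • EuclideanSpace.single i (1 : ℝ) := by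
      simpa using ((EuclideanSpace.basisFun (Fin n) ℝ).sum_repr z).symm
    conv_lhs => rw [hz, map_sum, ← hz, Finset.sum_mul]
    refine Finset.sum_congr rfl fun i _ => ?_
    simp [EuclideanSpace.inner_single_right]
    ring
  have hc (i : Fin n) := contDiff_fderiv_apply hf (EuclideanSpace.single i (1 : ℝ))
  simp_rw [hexp, lap, Finset.sum_mul]
  rw [integral_finsetSum, integral_finsetSum, Finset.mul_sum]
  · exact Finset.sum_congr rfl fun i _ => integral_mul_inner_paraboloid (hc i) x _ R
  · exact fun i _ => integrable_mul_paraboloid_sq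
      ((((hc i).continuous_fderiv (by norm_num)).comp (by fun_prop :
        Continuous fun z : 𝔼 => x + R • z)).clm_apply continuous_const)
  · intro i _
    have h := (hc i).continuous.comp (by fun_prop : Continuous fun z : 𝔼 => x + R • z)
    simpa only [Pi.mul_apply, Function.comp_apply, mul_assoc] using integrable_mul_paraboloid
      (h.mul (by fun_prop : Continuous fun z : 𝔼 => inner ℝ z (EuclideanSpace.single i (1 : ℝ))))

/-- Sub-mean value property of subharmonic functions for paraboloid-weighted means. -/
lemma mul_integral_paraboloid_le_of_lap_nonneg (hf : ContDiff ℝ 2 f) (hlap : ∀ y, 0 ≤ lap f y)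
    (x : 𝔼) {R : ℝ} (hR : 0 ≤ R) :
    f x * ∫ z : 𝔼, paraboloid z ≤ ∫ z, f (x + R • z) * paraboloid z := by
  have hd := hasDerivAt_paraboloidMean hf x
  have hmono : MonotoneOn (fun R : ℝ => ∫ z, f (x + R • z) * paraboloid z) (Set.Ici 0) := by
    refine monotoneOn_of_deriv_nonneg (convex_Ici 0)
      (fun r _ => (hd r).continuousAt.continuousWithinAt)
      (fun r _ => (hd r).differentiableAt.differentiableWithinAt) fun r hr => ?_
    rw [interior_Ici, Set.mem_Ioi] at hr
    rw [(hd r).deriv, integral_fderiv_mul_paraboloid hf]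
    exact mul_nonneg (by positivity)
      (integral_nonneg fun z => mul_nonneg (hlap _) (sq_nonneg _))
  simpa [integral_const_mul] using hmono (Set.mem_Ici.2 le_rfl) hR hR

/-- Rescaling a paraboloid-weighted mean to an integral in the original variable. -/
lemma integral_comp_mul_paraboloid (g : 𝔼 → ℝ) (x : 𝔼) {R : ℝ} (hR : 0 < R) :
    ∫ z, g (x + R • z) * paraboloid z
      = (R ^ n)⁻¹ * ∫ y, g y * paraboloid (R⁻¹ • (y - x)) := by
  have h := Measure.integral_comp_smul (μ := (volume : Measure 𝔼))
    (fun w => g (x + w) * paraboloid (R⁻¹ • w)) R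
  simp only [smul_smul, inv_mul_cancel₀ hR.ne', one_smul, finrank_euclideanSpace_fin,
    smul_eq_mul, abs_of_pos (inv_pos.2 (pow_pos hR n))] at h
  rw [h, ← integral_add_left_eq_self (fun y => g y * paraboloid (R⁻¹ • (y - x))) x]
  simp

lemma paraboloid_le_paraboloid_double {E : Type*} [NormedAddCommGroup E] [NormedSpace ℝ E]
    {x x₀ : E} {R : ℝ} (hR : 0 < R) (hx : 2 * ‖x - x₀‖ ≤ R) (y : E) :
    paraboloid (R⁻¹ • (y - x)) ≤ 3 * paraboloid ((2 * R)⁻¹ • (y - x₀)) := by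
  rcases le_total 1 ‖R⁻¹ • (y - x)‖ with h | h
  · rw [paraboloid_eq_zero h]
    exact mul_nonneg (by norm_num) (paraboloid_nonneg _)
  · rw [norm_smul, Real.norm_of_nonneg (inv_nonneg.2 hR.le), inv_mul_le_iff₀ hR, mul_one] at h
    have h1 : ‖(2 * R)⁻¹ • (y - x₀)‖ ≤ 3 / 4 := by
      rw [norm_smul, Real.norm_of_nonneg (by positivity), inv_mul_le_iff₀ (by positivity)]
      have := norm_sub_le_norm_sub_add_norm_sub y x x₀
      linarith
    have h2 : 1 - ‖(2 * R)⁻¹ • (y - x₀)‖ ^ 2 ≤ paraboloid ((2 * R)⁻¹ • (y - x₀)) :=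
      le_max_left _ _
    have h3 := paraboloid_le_one (R⁻¹ • (y - x))
    nlinarith [norm_nonneg ((2 * R)⁻¹ • (y - x₀))]

/-- Comparison of paraboloid-weighted means of a nonnegative function at two centers. -/
lemma integral_paraboloid_le_double {g : 𝔼 → ℝ} (hg : Continuous g) (hg0 : ∀ y, 0 ≤ g y)
    {x x₀ : 𝔼} {R : ℝ} (hR : 0 < R) (hx : 2 * ‖x - x₀‖ ≤ R) :
    ∫ z, g (x + R • z) * paraboloid z
      ≤ 3 * 2 ^ n * ∫ z, g (x₀ + (2 * R) • z) * paraboloid z := by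
  have hint {r : ℝ} (hr : 0 < r) (c : 𝔼) :
      Integrable fun y => g y * paraboloid (r⁻¹ • (y - c)) := by
    have h1 := integrable_mul_paraboloid (n := n) (g := fun z => g (c + r • z))
      (hg.comp (by fun_prop))
    have h2 := (h1.comp_smul (inv_ne_zero hr.ne')).comp_sub_right c
    simpa [smul_smul, hr.ne'] using h2
  have h2R : 0 < 2 * R := by positivity
  rw [integral_comp_mul_paraboloid g x hR, integral_comp_mul_paraboloid g x₀ h2R]
  have hle : ∫ y, g y * paraboloid (R⁻¹ • (y - x))
      ≤ 3 * ∫ y, g y * paraboloid ((2 * R)⁻¹ • (y - x₀)) := by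
    rw [← integral_const_mul]
    refine integral_mono (hint hR x) ((hint h2R x₀).const_mul 3) fun y => ?_
    have := mul_le_mul_of_nonneg_left (paraboloid_le_paraboloid_double hR hx y) (hg0 y)
    simp only
    linarith
  calc _ ≤ (R ^ n)⁻¹ * (3 * ∫ y, g y * paraboloid ((2 * R)⁻¹ • (y - x₀))) := by gcongr
    _ = _ := by
      rw [mul_pow]
      field_simp

end Mean

section Laplacian

variable {n : ℕ} {u : EuclideanSpace ℝ (Fin n) → ℝ}

lemma lap_neg (u : EuclideanSpace ℝ (Fin n) → ℝ) (x : EuclideanSpace ℝ (Fin n)) :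
    lap (fun y => -u y) x = -lap u x := by
  simp [lap, fderiv_fun_neg]

lemma norm_gradient_sq (u : EuclideanSpace ℝ (Fin n) → ℝ) (x : EuclideanSpace ℝ (Fin n)) :
    ‖gradient u x‖ ^ 2 = ∑ i, fderiv ℝ u x (EuclideanSpace.single i 1) ^ 2 := by
  rw [EuclideanSpace.real_norm_sq_eq]
  refine Finset.sum_congr rfl fun i _ => ?_
  rw [← InnerProductSpace.toDual_symm_apply (𝕜 := ℝ)]
  rw [EuclideanSpace.inner_single_right]
  simp [gradient]

lemma lap_exp_mul (hu : ContDiff ℝ 2 u) (G : ℝ) (x : EuclideanSpace ℝ (Fin n)) :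
    lap (fun y => Real.exp (G * u y)) x
      = G * Real.exp (G * u x) * (lap u x + G * ‖gradient u x‖ ^ 2) := by
  have hexp (y : EuclideanSpace ℝ (Fin n)) : HasFDerivAt (fun y => Real.exp (G * u y))
      (Real.exp (G * u y) • (G • fderiv ℝ u y)) y :=
    (((hu.differentiable (by norm_num)) y).hasFDerivAt.const_mul G).exp
  rw [norm_gradient_sq, lap, lap, Finset.mul_sum, ← Finset.sum_add_distrib, Finset.mul_sum]
  refine Finset.sum_congr rfl fun i _ => ?_
  have h1 : (fun y => fderiv ℝ (fun y => Real.exp (G * u y)) y (EuclideanSpace.single i 1))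
      = fun y => Real.exp (G * u y) * (G * fderiv ℝ u y (EuclideanSpace.single i 1)) := by
    ext y
    simp [(hexp y).fderiv]
  have h2 := ((contDiff_fderiv_apply hu (EuclideanSpace.single i (1 : ℝ))).differentiable
    (by norm_num) x).hasFDerivAt.const_mul G
  rw [h1, ((hexp x).fun_mul h2).fderiv]
  simp
  ring

end Laplacian

/-- A bounded superharmonic function `u` whose exponential `exp (G * u)` is subharmonic,
i.e. `0 ≤ -Δu ≤ G |∇u|²`, is constant. -/
theorem eq_of_bounded_of_neg_lap_le {n : ℕ} {u : EuclideanSpace ℝ (Fin n) → ℝ}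
    (hu : ContDiff ℝ 2 u) {m₀ M G : ℝ} (hm₀ : ∀ x, m₀ ≤ u x) (hM : ∀ x, u x ≤ M) (hG : 0 < G)
    (hsuper : ∀ x, 0 ≤ -lap u x) (hsub : ∀ x, -lap u x ≤ G * ‖gradient u x‖ ^ 2)
    (x y : EuclideanSpace ℝ (Fin n)) : u x = u y := by
  have hbdd : BddBelow (Set.range u) := ⟨m₀, Set.forall_mem_range.2 hm₀⟩
  set m := ⨅ z, u z with hm
  have hmle (z) : m ≤ u z := ciInf_le hbdd z
  suffices h : ∀ x, u x = m by rw [h x, h y]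
  clear x y
  intro x
  refine le_antisymm ?_ (hmle x)
  set c := ∫ z : EuclideanSpace ℝ (Fin n), paraboloid z with hc
  have hcpos : 0 < c := integral_paraboloid_pos volume
  set w := fun y => Real.exp (G * u y) with hw
  have hwC : ContDiff ℝ 2 w := (contDiff_const.mul hu).exp
  have hwlap (y) : 0 ≤ lap w y := by
    rw [hw, lap_exp_mul hu]
    have := hsub y
    exact mul_nonneg (by positivity) (by linarith)
  have hwle (y) : w y - Real.exp (G * m) ≤ G * Real.exp (G * M) * (u y - m) := by
    have h1 := Real.add_one_le_exp (G * m - G * u y)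
    have h2 : Real.exp (G * m) = w y * Real.exp (G * m - G * u y) := by
      rw [hw, ← Real.exp_add]
      ring_nf
    have h3 : w y ≤ Real.exp (G * M) :=
      Real.exp_le_exp.2 (mul_le_mul_of_nonneg_left (hM y) hG.le)
    have h4 : 0 < w y := Real.exp_pos _
    calc w y - Real.exp (G * m) ≤ w y * (G * (u y - m)) := by rw [h2]; nlinarith
      _ ≤ Real.exp (G * M) * (G * (u y - m)) :=
        mul_le_mul_of_nonneg_right h3 (mul_nonneg hG.le (sub_nonneg.2 (hmle y)))
      _ = _ := by ring
  have hnear (x₀) : w x - Real.exp (G * m)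
      ≤ G * Real.exp (G * M) * (3 * 2 ^ n) * (u x₀ - m) := by
    set R := 2 * ‖x - x₀‖ + 1 with hRdef
    have hR : 0 < R := by positivity
    have hcomp (y : EuclideanSpace ℝ (Fin n)) (r : ℝ) :
        Continuous fun z : EuclideanSpace ℝ (Fin n) => u (y + r • z) :=
      hu.continuous.comp (by fun_prop)
    have hwcomp : Continuous fun z : EuclideanSpace ℝ (Fin n) => w (x + R • z) :=
      hwC.continuous.comp (by fun_prop)
    have hupper : ∫ z, (u (x₀ + (2 * R) • z) - m) * paraboloid z ≤ (u x₀ - m) * c := by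
      have h := mul_integral_paraboloid_le_of_lap_nonneg hu.neg
        (fun y => (hsuper y).trans_eq (lap_neg u y).symm) x₀ (R := 2 * R) (by positivity)
      simp_rw [sub_mul]
      rw [integral_sub (integrable_mul_paraboloid (hcomp _ _))
        (integrable_mul_paraboloid continuous_const), integral_const_mul]
      simp only [neg_mul, integral_neg] at h
      linarith
    have hlower : (w x - Real.exp (G * m)) * c
        ≤ ∫ z, (w (x + R • z) - Real.exp (G * m)) * paraboloid z := by
      have h := mul_integral_paraboloid_le_of_lap_nonneg hwC hwlap x hR.le
      simp_rw [sub_mul]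
      rw [integral_sub (integrable_mul_paraboloid hwcomp)
        (integrable_mul_paraboloid continuous_const), integral_const_mul]
      linarith
    have hmid : ∫ z, (w (x + R • z) - Real.exp (G * m)) * paraboloid z
        ≤ G * Real.exp (G * M) * ∫ z, (u (x + R • z) - m) * paraboloid z := by
      rw [← integral_const_mul]
      refine integral_mono (integrable_mul_paraboloid (hwcomp.sub continuous_const))
        ((integrable_mul_paraboloid ((hcomp _ _).sub continuous_const)).const_mul _) fun z => ?_
      simp only [← mul_assoc]
      exact mul_le_mul_of_nonneg_right (hwle _) (paraboloid_nonneg z)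
    have hdouble := integral_paraboloid_le_double (g := fun y => u y - m)
      (hu.continuous.sub continuous_const) (fun y => sub_nonneg.2 (hmle y)) hR
      (x := x) (x₀ := x₀) (by linarith)
    refine le_of_mul_le_mul_right ?_ hcpos
    calc _ ≤ _ := hlower
      _ ≤ _ := hmid
      _ ≤ G * Real.exp (G * M) * (3 * 2 ^ n * ((u x₀ - m) * c)) := by
        gcongr
        exact hdouble.trans (mul_le_mul_of_nonneg_left hupper (by positivity))
      _ = _ := by ring
  set K := G * Real.exp (G * M) * (3 * 2 ^ n) with hK
  have hKpos : 0 < K := by positivity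
  have hfinal : m + (w x - Real.exp (G * m)) / K ≤ m := by
    conv_rhs => rw [hm]
    refine le_ciInf fun x₀ => ?_
    have : (w x - Real.exp (G * m)) / K ≤ u x₀ - m :=
      (div_le_iff₀' hKpos).2 (hnear x₀)
    linarith
  have hwx : w x ≤ Real.exp (G * m) := by
    have : (w x - Real.exp (G * m)) / K ≤ 0 := by linarith
    rw [div_le_iff₀ hKpos] at this
    linarith
  exact le_of_mul_le_mul_left (Real.exp_le_exp.1 hwx) hG

/-- Nonnegative bounded solutions of `-Δu = u^q v^r |∇u|²` with `v` nonnegative and bounded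
are constant. -/
theorem eq_of_neg_lap_eq_rpow_mul {n : ℕ} {q r : ℝ} (hq : 0 ≤ q) (hr : 0 ≤ r)
    {u v : EuclideanSpace ℝ (Fin n) → ℝ} (hu0 : ∀ x, 0 ≤ u x) (hv0 : ∀ x, 0 ≤ v x)
    (hu_bdd : ∃ M : ℝ, ∀ x, u x ≤ M) (hv_bdd : ∃ M : ℝ, ∀ x, v x ≤ M) (hu : ContDiff ℝ 2 u)
    (heq : ∀ x, -lap u x = u x ^ q * v x ^ r * ‖gradient u x‖ ^ 2)
    (x y : EuclideanSpace ℝ (Fin n)) : u x = u y := by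
  obtain ⟨M, hM⟩ := hu_bdd
  obtain ⟨N, hN⟩ := hv_bdd
  have hM0 : 0 ≤ M := (hu0 0).trans (hM 0)
  have hN0 : 0 ≤ N := (hv0 0).trans (hN 0)
  have hMN : 0 ≤ M ^ q * N ^ r := by positivity
  refine eq_of_bounded_of_neg_lap_le hu hu0 hM (G := M ^ q * N ^ r + 1) (by positivity)
    (fun z => ?_) (fun z => ?_) x y
  · rw [heq]
    have := Real.rpow_nonneg (hu0 z) q
    have := Real.rpow_nonneg (hv0 z) r
    positivity
  · rw [heq]
    refine mul_le_mul_of_nonneg_right ?_ (sq_nonneg _)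
    have : u z ^ q * v z ^ r ≤ M ^ q * N ^ r :=
      mul_le_mul (Real.rpow_le_rpow (hu0 z) (hM z) hq) (Real.rpow_le_rpow (hv0 z) (hN z) hr)
        (Real.rpow_nonneg (hv0 z) r) (Real.rpow_nonneg hM0 q)
    linarith

/-- **Liouville theorem for the model system with `p₁ = p₂ = 2`** (Remark 1.2(a)):
any pair of nonnegative bounded classical solutions of
`-Δu = u^{q₁} v^{r₁} |∇u|²`, `-Δv = v^{q₂} u^{r₂} |∇v|²` in `ℝⁿ` is constant. -/
theorem liouville_model_system_quadratic {n : ℕ} (hn : 1 ≤ n)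
    {q₁ q₂ r₁ r₂ : ℝ} (hq₁ : 0 ≤ q₁) (hq₂ : 0 ≤ q₂) (hr₁ : 0 ≤ r₁) (hr₂ : 0 ≤ r₂)
    (u v : EuclideanSpace ℝ (Fin n) → ℝ)
    (hu_nonneg : ∀ x, 0 ≤ u x) (hv_nonneg : ∀ x, 0 ≤ v x)
    (hu_bdd : ∃ M : ℝ, ∀ x, u x ≤ M) (hv_bdd : ∃ M : ℝ, ∀ x, v x ≤ M)
    (hu_C2 : ContDiff ℝ 2 u) (hv_C2 : ContDiff ℝ 2 v)
    (hequ : ∀ x, -lap u x = u x ^ q₁ * v x ^ r₁ * ‖gradient u x‖ ^ 2)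
    (heqv : ∀ x, -lap v x = v x ^ q₂ * u x ^ r₂ * ‖gradient v x‖ ^ 2) :
    (∀ x y, u x = u y) ∧ (∀ x y, v x = v y) := by
  exact ⟨eq_of_neg_lap_eq_rpow_mul hq₁ hr₁ hu_nonneg hv_nonneg hu_bdd hv_bdd hu_C2 hequ,
    eq_of_neg_lap_eq_rpow_mul hq₂ hr₂ hv_nonneg hu_nonneg hv_bdd hu_bdd hv_C2 heqv⟩
end

section
/- Let n ≥ 1, p ≥ 2 and q > 0, and let u : ℝ^n → ℝ be a positive, bounded, twice continuously differentiable function satisfying -Δu = u^q |∇u|^p pointwise on ℝ^n. Assume moreover that the function u^{q+1}|∇u|^{p-2} is bounded on ℝ^n, set ℓ = lim_{R→∞} ū(R) where ū(R) is the average of u over the sphere of radius R centered at the origin (this limit exists and u ≥ ℓ since u is superharmonic), and let s be a real number with s ≥ 2 and s ≥ 1 + sup_{ℝ^n} u^{q+1}|∇u|^{p-2}. Then the function z = (u - ℓ)^s satisfies Δz ≥ 0 everywhere on ℝ^n, i.e. z is subharmonic. -/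
open MeasureTheory Filter

/-- The spherical average `ū(R) = |S_R|⁻¹ ∫_{S_R} u dσ` of `u` over the sphere of radius `R`
centered at the origin.  It is computed by parametrizing `S_R` by the unit sphere via
`y ↦ R • y`: since the surface measure on `S_R` is the image under this map of a constant
multiple of the surface measure `volume.toSphere` on the unit sphere, the normalized
average over `S_R` coincides with the normalized average over the unit sphere of
`y ↦ u (R • y)`. -/
noncomputable def sphAvg {n : ℕ} (u : EuclideanSpace ℝ (Fin n) → ℝ) (R : ℝ) : ℝ :=
  ⨍ y : Metric.sphere (0 : EuclideanSpace ℝ (Fin n)) 1,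
    u (R • (y : EuclideanSpace ℝ (Fin n)))
      ∂(volume : Measure (EuclideanSpace ℝ (Fin n))).toSphere

/-- The squared norm of the gradient is the sum of the squared partial derivatives. -/
lemma norm_gradient_sq_eq_sum {n : ℕ} (u : EuclideanSpace ℝ (Fin n) → ℝ)
    (x : EuclideanSpace ℝ (Fin n)) :
    ‖gradient u x‖ ^ 2 = ∑ i, (fderiv ℝ u x (EuclideanSpace.single i (1 : ℝ))) ^ 2 := by
  rw [EuclideanSpace.real_norm_sq_eq]
  refine Finset.sum_congr rfl fun i _ => ?_
  have h : inner ℝ (gradient u x) (EuclideanSpace.single i (1 : ℝ))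
      = fderiv ℝ u x (EuclideanSpace.single i (1 : ℝ)) := by
    simp only [gradient, InnerProductSpace.toDual_symm_apply]
  rw [← h, EuclideanSpace.inner_single_right]
  simp

/-- Chain rule for the Laplacian of a real power of a function shifted by a constant,
for exponents at least `2`. -/
lemma lap_sub_const_rpow {n : ℕ} {u : EuclideanSpace ℝ (Fin n) → ℝ} (hu : ContDiff ℝ 2 u)
    (c : ℝ) {s : ℝ} (hs : 2 ≤ s) (x : EuclideanSpace ℝ (Fin n)) :
    lap (fun y => (u y - c) ^ s) x
      = s * (s - 1) * (u x - c) ^ (s - 2) * ‖gradient u x‖ ^ 2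
        + s * (u x - c) ^ (s - 1) * lap u x := by
  have hd (y) : HasFDerivAt (fun y => u y - c) (fderiv ℝ u y) y :=
    ((hu.differentiable (by norm_num)) y).hasFDerivAt.sub_const c
  have hfirst (y) : fderiv ℝ (fun y => (u y - c) ^ s) y
      = (s * (u y - c) ^ (s - 1)) • fderiv ℝ u y :=
    ((hd y).rpow_const (Or.inr (by linarith))).fderiv
  have hpow : HasFDerivAt (fun y => s * (u y - c) ^ (s - 1))
      (s • (((s - 1) * (u x - c) ^ (s - 2)) • fderiv ℝ u x)) x := by
    have h := ((hd x).rpow_const (p := s - 1) (Or.inr (by linarith))).const_mul s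
    rwa [show s - 1 - 1 = s - 2 by ring] at h
  rw [norm_gradient_sq_eq_sum]
  unfold lap
  rw [Finset.mul_sum, Finset.mul_sum, ← Finset.sum_add_distrib]
  refine Finset.sum_congr rfl fun i _ => ?_
  have hpartial : DifferentiableAt ℝ
      (fun y => fderiv ℝ u y (EuclideanSpace.single i (1 : ℝ))) x :=
    (((hu.fderiv_right (m := 1) (by norm_num)).clm_apply contDiff_const).differentiable
      (by norm_num)) x
  simp only [hfirst, smul_apply, smul_eq_mul]
  rw [fderiv_fun_mul hpow.differentiableAt hpartial, hpow.fderiv]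
  simp only [add_apply, smul_apply, smul_eq_mul]
  ring

lemma sphAvg_nonneg {n : ℕ} {u : EuclideanSpace ℝ (Fin n) → ℝ} (hu : ∀ x, 0 ≤ u x) (R : ℝ) :
    0 ≤ sphAvg u R :=
  integral_nonneg fun _ => hu _

/-- **Subharmonicity of `(u - ℓ)^s`** (key step in the proof of Theorem 1.1): if `u` is a
positive bounded classical solution of `-Δu = u^q |∇u|^p` with `p ≥ 2`, `q > 0`, if
`u^{q+1}|∇u|^{p-2}` is bounded, `ℓ = lim_{R→∞} ū(R)` (which exists, with `u ≥ ℓ`, since `u`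
is superharmonic), and `s ≥ 2` satisfies `s ≥ 1 + sup (u^{q+1}|∇u|^{p-2})`, then
`z = (u - ℓ)^s` is subharmonic on `ℝⁿ`. -/
theorem subharmonic_power {n : ℕ} (hn : 1 ≤ n) {p q : ℝ} (hp : 2 ≤ p) (hq : 0 < q)
    (u : EuclideanSpace ℝ (Fin n) → ℝ)
    (hu_pos : ∀ x, 0 < u x)
    (hu_bdd : ∃ M : ℝ, ∀ x, u x ≤ M)
    (hu_C2 : ContDiff ℝ 2 u)
    (heq : ∀ x, -lap u x = u x ^ q * ‖gradient u x‖ ^ p)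
    (hB : ∃ C : ℝ, ∀ x, u x ^ (q + 1) * ‖gradient u x‖ ^ (p - 2) ≤ C)
    (ℓ : ℝ) (hℓ : Tendsto (sphAvg u) atTop (nhds ℓ))
    (hℓ_le : ∀ x, ℓ ≤ u x)
    (s : ℝ) (hs2 : 2 ≤ s)
    (hs : 1 + (⨆ x, u x ^ (q + 1) * ‖gradient u x‖ ^ (p - 2)) ≤ s) :
    ∀ x, 0 ≤ lap (fun y => (u y - ℓ) ^ s) x := by
  intro x
  have hℓ0 : 0 ≤ ℓ :=
    ge_of_tendsto' hℓ fun R => sphAvg_nonneg (fun y => (hu_pos y).le) R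
  have hw : 0 ≤ u x - ℓ := sub_nonneg.2 (hℓ_le x)
  have hbound : u x ^ (q + 1) * ‖gradient u x‖ ^ (p - 2) ≤ s - 1 := by
    obtain ⟨C, hC⟩ := hB
    have := le_ciSup (f := fun x => u x ^ (q + 1) * ‖gradient u x‖ ^ (p - 2))
      ⟨C, by rintro _ ⟨y, rfl⟩; exact hC y⟩ x
    linarith
  have hgrad : ‖gradient u x‖ ^ p = ‖gradient u x‖ ^ (p - 2) * ‖gradient u x‖ ^ 2 := by
    rw [← Real.rpow_two, ← Real.rpow_add' (norm_nonneg _) (by linarith), sub_add_cancel]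
  have hpow : (u x - ℓ) ^ (s - 1) = (u x - ℓ) ^ (s - 2) * (u x - ℓ) := by
    rw [← Real.rpow_add_one' hw (by linarith)]
    congr 1
    ring
  have hsource : (u x - ℓ) * u x ^ q * ‖gradient u x‖ ^ (p - 2) ≤ s - 1 := by
    refine le_trans ?_ hbound
    rw [Real.rpow_add_one (hu_pos x).ne', mul_comm (u x ^ q)]
    have := (hu_pos x).le
    gcongr
    linarith
  have hlap : lap u x = -(u x ^ q * ‖gradient u x‖ ^ p) := by rw [← heq x, neg_neg]
  rw [lap_sub_const_rpow hu_C2 ℓ hs2, hlap, hgrad, hpow]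
  have hfactor : 0 ≤ s * (u x - ℓ) ^ (s - 2) * ‖gradient u x‖ ^ 2 := by positivity
  have := mul_nonneg hfactor (sub_nonneg.2 hsource)
  linarith
end

section
/- Let n ≥ 1, p > 2 and q > 0, set m = (p-2)/(q+p-1) ∈ (0,1), and let u : ℝ^n → ℝ be a positive, bounded, twice continuously differentiable function satisfying -Δu = u^q |∇u|^p pointwise on ℝ^n. Set v = u^{1/m} = u^{(q+p-1)/(p-2)}. Then there exists a constant C > 0 depending only on n, p, q such that |∇v(x)| ≤ C(1 + ‖v‖_∞) for every x ∈ ℝ^n; in particular ∇v is bounded on ℝ^n. -/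
open Filter Topology

/-- Second-order necessary condition at a local maximum of a function of one variable. -/
theorem IsLocalMax.hasDerivAt_deriv_nonpos {f f' : ℝ → ℝ} {a c : ℝ} (h : IsLocalMax f a)
    (hf : ∀ t, HasDerivAt f (f' t) t) (hf' : HasDerivAt f' c a) : c ≤ 0 := by
  by_contra! hc
  have hd : deriv f = f' := funext fun t => (hf t).deriv
  have hmin : IsLocalMin f a :=
    isLocalMin_of_deriv_deriv_pos (by rwa [hd, hf'.deriv]) h.deriv_eq_zero (hf a).continuousAt
  have hconst : f =ᶠ[𝓝 a] fun _ => f a := by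
    filter_upwards [h, hmin] with t h₁ h₂ using le_antisymm h₁ h₂
  have hzero : deriv (deriv f) a = 0 := by
    rw [hconst.deriv.deriv_eq]
    simp
  rw [hd, hf'.deriv] at hzero
  exact hc.ne' hzero

theorem norm_gradient_eq_norm_fderiv {F : Type*} [NormedAddCommGroup F] [InnerProductSpace ℝ F]
    [CompleteSpace F] (f : F → ℝ) (x : F) : ‖gradient f x‖ = ‖fderiv ℝ f x‖ := by
  simp [gradient]

theorem sum_sq_fderiv_single {n : ℕ} (f : EuclideanSpace ℝ (Fin n) → ℝ)
    (x : EuclideanSpace ℝ (Fin n)) :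
    ∑ i, (fderiv ℝ f x (EuclideanSpace.single i (1 : ℝ))) ^ 2 = ‖gradient f x‖ ^ 2 := by
  rw [EuclideanSpace.norm_sq_eq]
  refine Finset.sum_congr rfl fun i _ => ?_
  rw [← inner_gradient_left, EuclideanSpace.inner_single_right]
  simp

theorem ContDiff.differentiable_fderiv_apply {F : Type*} [NormedAddCommGroup F] [NormedSpace ℝ F]
    {f : F → ℝ} (hf : ContDiff ℝ 2 f) (e : F) : Differentiable ℝ fun y => fderiv ℝ f y e :=
  ((hf.fderiv_right (m := 1) (by norm_num)).differentiable (by norm_num)).clm_apply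
    (differentiable_const e)

theorem lap_rpow {n : ℕ} {u : EuclideanSpace ℝ (Fin n) → ℝ} (hu : ContDiff ℝ 2 u)
    (hpos : ∀ x, 0 < u x) (k : ℝ) (x : EuclideanSpace ℝ (Fin n)) :
    lap (fun y => u y ^ k) x =
      k * u x ^ (k - 1) * lap u x + k * (k - 1) * u x ^ (k - 2) * ‖gradient u x‖ ^ 2 := by
  have hd : Differentiable ℝ u := hu.differentiable (by norm_num)
  have hfd : ∀ (j : ℝ) y, HasFDerivAt (fun z => u z ^ j) ((j * u y ^ (j - 1)) • fderiv ℝ u y) y :=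
    fun j y => (hd y).hasFDerivAt.rpow_const (Or.inl (hpos y).ne')
  rw [← sum_sq_fderiv_single, lap, lap, Finset.mul_sum, Finset.mul_sum, ← Finset.sum_add_distrib]
  refine Finset.sum_congr rfl fun i _ => ?_
  have heq : (fun y => fderiv ℝ (fun z => u z ^ k) y (EuclideanSpace.single i (1 : ℝ))) =
      fun y => (k * u y ^ (k - 1)) * fderiv ℝ u y (EuclideanSpace.single i (1 : ℝ)) := by
    funext y
    rw [(hfd k y).fderiv]
    simp
  rw [heq, (((hfd (k - 1) x).const_mul k).fun_mul
    (hu.differentiable_fderiv_apply (EuclideanSpace.single i (1 : ℝ)) x).hasFDerivAt).fderiv]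
  simp only [add_apply, smul_apply, smul_eq_mul]
  rw [show k - 1 - 1 = k - 2 by ring]
  ring

theorem norm_gradient_rpow {n : ℕ} {u : EuclideanSpace ℝ (Fin n) → ℝ} (hu : Differentiable ℝ u)
    (hpos : ∀ x, 0 < u x) {k : ℝ} (hk : 0 < k) (x : EuclideanSpace ℝ (Fin n)) :
    ‖gradient (fun y => u y ^ k) x‖ = k * u x ^ (k - 1) * ‖gradient u x‖ := by
  rw [norm_gradient_eq_norm_fderiv, norm_gradient_eq_norm_fderiv,
    ((hu x).hasFDerivAt.rpow_const (Or.inl (hpos x).ne')).fderiv, norm_smul, Real.norm_of_nonneg]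
  have := hpos x
  positivity

/-- At a maximum of `v (x + ·) - v (y + ·) - ε ‖x + ·‖²` the Laplacians are ordered. -/
theorem lap_sub_lap_le_of_isMax {n : ℕ} {v : EuclideanSpace ℝ (Fin n) → ℝ} (hv : ContDiff ℝ 2 v)
    {ε : ℝ} {x y : EuclideanSpace ℝ (Fin n)}
    (hmax : ∀ h, v (x + h) - v (y + h) - ε * ‖x + h‖ ^ 2 ≤ v x - v y - ε * ‖x‖ ^ 2) :
    lap v x - lap v y ≤ 2 * n * ε := by
  have hd : Differentiable ℝ v := hv.differentiable (by norm_num)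
  have key : ∀ i : Fin n,
      fderiv ℝ (fun y => fderiv ℝ v y (EuclideanSpace.single i (1 : ℝ))) x
          (EuclideanSpace.single i (1 : ℝ)) -
        fderiv ℝ (fun y => fderiv ℝ v y (EuclideanSpace.single i (1 : ℝ))) y
          (EuclideanSpace.single i (1 : ℝ)) - 2 * ε ≤ 0 := by
    intro i
    set e : EuclideanSpace ℝ (Fin n) := EuclideanSpace.single i (1 : ℝ) with he
    have hne : ‖e‖ = 1 := by simp [he]
    have hline : ∀ (z : EuclideanSpace ℝ (Fin n)) (t : ℝ),
        HasDerivAt (fun s : ℝ => z + s • e) e t := fun z t => by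
      simpa using ((hasDerivAt_id t).smul_const e).const_add z
    have hsq : ∀ t : ℝ, ‖x + t • e‖ ^ 2 = ‖x‖ ^ 2 + 2 * inner ℝ x e * t + t ^ 2 := fun t => by
      rw [norm_add_sq_real, norm_smul, inner_smul_right, hne, Real.norm_eq_abs, mul_one, sq_abs]
      ring
    have hd2 := hv.differentiable_fderiv_apply e
    refine IsLocalMax.hasDerivAt_deriv_nonpos (a := 0)
      (f := fun t => v (x + t • e) - v (y + t • e)
        - ε * (‖x‖ ^ 2 + 2 * inner ℝ x e * t + t ^ 2))
      (f' := fun t => fderiv ℝ v (x + t • e) e - fderiv ℝ v (y + t • e) e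
        - ε * (2 * inner ℝ x e + 2 * t)) ?_ ?_ ?_
    · refine Eventually.of_forall fun t => ?_
      have := hmax (t • e)
      rw [hsq] at this
      simpa using this
    · intro t
      refine (((hd _).hasFDerivAt.comp_hasDerivAt t (hline x t)).sub
        ((hd _).hasFDerivAt.comp_hasDerivAt t (hline y t))).sub (HasDerivAt.const_mul ε ?_)
      have h₁ : HasDerivAt (fun t : ℝ => 2 * inner ℝ x e * t) (2 * inner ℝ x e) t := by
        simpa using (hasDerivAt_id t).const_mul (2 * inner ℝ x e)
      simpa using (h₁.const_add (‖x‖ ^ 2)).fun_add (hasDerivAt_pow 2 t)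
    · have h₁ := (hd2 (x + (0 : ℝ) • e)).hasFDerivAt.comp_hasDerivAt 0 (hline x 0)
      have h₂ := (hd2 (y + (0 : ℝ) • e)).hasFDerivAt.comp_hasDerivAt 0 (hline y 0)
      have h₃ : HasDerivAt (fun t : ℝ => ε * (2 * inner ℝ x e + 2 * t)) (2 * ε) 0 := by
        simpa [mul_comm] using
          (((hasDerivAt_id (0 : ℝ)).const_mul 2).const_add (2 * inner ℝ x e)).const_mul ε
      have h := (h₁.sub h₂).sub h₃
      simp only [zero_smul, add_zero] at h
      exact h
  have hsum := Finset.sum_nonpos fun i (_ : i ∈ Finset.univ) => key i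
  rw [Finset.sum_sub_distrib, Finset.sum_sub_distrib] at hsum
  simp only [Finset.sum_const, Finset.card_univ, Fintype.card_fin, nsmul_eq_mul] at hsum
  rw [lap, lap]
  linarith

/-- At a maximum of `v (x + ·) - v (y + ·) - ε ‖x + ·‖²` the gradients are close. -/
theorem norm_fderiv_sub_fderiv_le_of_isMax {F : Type*} [NormedAddCommGroup F]
    [InnerProductSpace ℝ F] {v : F → ℝ} (hd : Differentiable ℝ v)
    {ε : ℝ} (hε : 0 ≤ ε) {x y : F}
    (hmax : ∀ h, v (x + h) - v (y + h) - ε * ‖x + h‖ ^ 2 ≤ v x - v y - ε * ‖x‖ ^ 2) :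
    ‖fderiv ℝ v x - fderiv ℝ v y‖ ≤ 2 * ε * ‖x‖ := by
  have hloc : IsLocalMax (fun h => v (x + h) - v (y + h) - ε * ‖x + h‖ ^ 2) 0 :=
    Eventually.of_forall fun h => by simpa using hmax h
  have hshift : ∀ z : F, HasFDerivAt (fun h => v (z + h)) (fderiv ℝ v z) 0 := fun z => by
    have := (hd (z + 0)).hasFDerivAt.comp (0 : F) ((hasFDerivAt_id (0 : F)).const_add z)
    simpa [Function.comp_def] using this
  have hsq : HasFDerivAt (fun h : F => ‖x + h‖ ^ 2) (2 • innerSL ℝ x) 0 := by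
    have := ((hasFDerivAt_id (0 : F)).const_add x).norm_sq
    simpa [Function.comp_def] using this
  have hz := hloc.hasFDerivAt_eq_zero (((hshift x).sub (hshift y)).sub (hsq.const_mul ε))
  rw [sub_eq_zero] at hz
  rw [hz, ← Nat.cast_smul_eq_nsmul ℝ, smul_smul, norm_smul, innerSL_apply_norm,
    Real.norm_of_nonneg (by positivity)]
  push_cast
  linarith

theorem norm_fderiv_eq_of_isMax {F : Type*} [NormedAddCommGroup F]
    [InnerProductSpace ℝ F] {v : F → ℝ} (hd : Differentiable ℝ v) {L : ℝ} (hL : 0 ≤ L) {x y : F}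
    (hxy : x ≠ y) (hmax : ∀ z, v x - v z - L * ‖z - x‖ ≤ v x - v y - L * ‖y - x‖) :
    ‖fderiv ℝ v y‖ = L := by
  have hloc : IsLocalMax (fun z => v x - v z - L * ‖z - x‖) y := Eventually.of_forall hmax
  have hyx : y - x ≠ 0 := sub_ne_zero.2 hxy.symm
  have : Nontrivial F := ⟨x, y, hxy⟩
  have hdn : DifferentiableAt ℝ (fun z : F => ‖z‖) (y - x) :=
    differentiableAt_id.norm ℝ hyx
  have hn : HasFDerivAt (fun z : F => ‖z - x‖) (fderiv ℝ (fun z : F => ‖z‖) (y - x)) y := by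
    have := hdn.hasFDerivAt.comp y ((hasFDerivAt_id y).sub_const x)
    simpa [Function.comp_def] using this
  have hz := hloc.hasFDerivAt_eq_zero
    (((hd y).hasFDerivAt.const_sub (v x)).sub (hn.const_mul L))
  rw [sub_eq_zero, neg_eq_iff_eq_neg] at hz
  rw [hz, norm_neg, norm_smul, norm_fderiv_norm hdn, Real.norm_of_nonneg hL, mul_one]

theorem exists_isMax_doubling {F : Type*} [NormedAddCommGroup F] [ProperSpace F]
    {v : F → ℝ} (hc : Continuous v) (hpos : ∀ x, 0 < v x) {M : ℝ} (hM : ∀ x, v x ≤ M)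
    {L ε : ℝ} (hL : 0 < L) (hε : 0 < ε) {x₀ y₀ : F}
    (h₀ : 0 < v x₀ - v y₀ - L * ‖y₀ - x₀‖ - ε * ‖x₀‖ ^ 2) :
    ∃ x y : F, ∀ x' y' : F, v x' - v y' - L * ‖y' - x'‖ - ε * ‖x'‖ ^ 2 ≤
      v x - v y - L * ‖y - x‖ - ε * ‖x‖ ^ 2 := by
  have hM0 : 0 < M := (hpos x₀).trans_le (hM x₀)
  set R : ℝ := M / ε + 1 + M / L
  have hcont : Continuous fun z : F × F =>
      v z.1 - v z.2 - L * ‖z.2 - z.1‖ - ε * ‖z.1‖ ^ 2 := by fun_prop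
  obtain ⟨z, hz⟩ := hcont.exists_forall_ge' (x₀, y₀) (by
    have hK : IsCompact (Metric.closedBall (0 : F) R ×ˢ Metric.closedBall (0 : F) R) :=
      (isCompact_closedBall _ _).prod (isCompact_closedBall _ _)
    filter_upwards [hK.compl_mem_cocompact] with z hz
    contrapose! hz
    have hlt := h₀.trans hz
    have h₁ : ε * ‖z.1‖ ^ 2 ≤ M := by
      nlinarith [hM z.1, hpos z.2, mul_nonneg hL.le (norm_nonneg (z.2 - z.1))]
    have h₂ : L * ‖z.2 - z.1‖ ≤ M := by
      nlinarith [hM z.1, hpos z.2, mul_nonneg hε.le (sq_nonneg ‖z.1‖)]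
    have h₃ : ‖z.1‖ ^ 2 ≤ M / ε := by rw [le_div_iff₀ hε]; linarith
    have h₄ : ‖z.2 - z.1‖ ≤ M / L := by rw [le_div_iff₀ hL]; linarith
    have h₅ : ‖z.1‖ ≤ M / ε + 1 := by nlinarith [sq_nonneg (‖z.1‖ - 1)]
    have h₆ : ‖z.2‖ ≤ ‖z.1‖ + ‖z.2 - z.1‖ := by
      simpa using norm_add_le z.1 (z.2 - z.1)
    have h₇ : 0 < M / L := by positivity
    simp only [Set.mem_compl_iff, not_not, Set.mem_prod, mem_closedBall_zero_iff]
    constructor <;> linarith)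
  exact ⟨z.1, z.2, fun x' y' => hz (x', y')⟩

/-- Doubling of variables: a bounded positive solution of `-Δv = H(|∇v|) / v` is `L`-Lipschitz as
soon as `H L > 0`. -/
theorem sub_le_mul_norm_sub_of_lap_eq {n : ℕ} {v : EuclideanSpace ℝ (Fin n) → ℝ}
    (hv : ContDiff ℝ 2 v) (hpos : ∀ x, 0 < v x) {M : ℝ} (hM : ∀ x, v x ≤ M)
    {H : ℝ → ℝ} {L : ℝ} (hH : ContinuousAt H L) (hL : 0 < L) (hHL : 0 < H L)
    (heq : ∀ x, -lap v x = H ‖gradient v x‖ / v x) (x₀ y₀ : EuclideanSpace ℝ (Fin n)) :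
    v x₀ - v y₀ ≤ L * ‖y₀ - x₀‖ := by
  by_contra! hlt
  have hd : Differentiable ℝ v := hv.differentiable (by norm_num)
  have hM0 : 0 < M := (hpos x₀).trans_le (hM x₀)
  obtain ⟨σ, hσ, hσeq⟩ : ∃ σ, 0 < σ ∧ v x₀ - v y₀ - L * ‖y₀ - x₀‖ = 2 * σ :=
    ⟨(v x₀ - v y₀ - L * ‖y₀ - x₀‖) / 2, by linarith, by ring⟩
  set c : ℝ := H L * σ / M ^ 2 with hc
  have hc0 : 0 < c := by positivity
  obtain ⟨η, hη, hHη⟩ := Metric.continuousAt_iff.1 hH (c * σ / 4) (by positivity)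
  have hsmall : ∀ a b : ℝ, 0 < b → ∀ᶠ ε in 𝓝[>] (0 : ℝ), ε * a < b := fun a b hb =>
    ((by fun_prop : Continuous fun ε : ℝ => ε * a).tendsto' 0 0 (by simp)).mono_left
      nhdsWithin_le_nhds |>.eventually_lt_const hb
  obtain ⟨ε, hε₁, hε₂, hε₃, hε⟩ := ((hsmall (‖x₀‖ ^ 2) σ hσ).and
    ((hsmall (4 * M) (η ^ 2) (by positivity)).and
      ((hsmall (2 * n) (c / 4) (by positivity)).and self_mem_nhdsWithin))).exists
  replace hε : 0 < ε := hε
  obtain ⟨x, y, hmax⟩ := exists_isMax_doubling hv.continuous hpos hM hL hε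
    (x₀ := x₀) (y₀ := y₀) (by linarith)
  have hval := hmax x₀ y₀
  have hn₁ : 0 ≤ L * ‖y - x‖ := by positivity
  have hn₂ : 0 ≤ ε * ‖x‖ ^ 2 := by positivity
  have hgap : σ ≤ v x - v y := by linarith
  have hxy : x ≠ y := by
    rintro rfl
    linarith
  have hdiag : ∀ h, v (x + h) - v (y + h) - ε * ‖x + h‖ ^ 2 ≤ v x - v y - ε * ‖x‖ ^ 2 :=
    fun h => by
      have := hmax (x + h) (y + h)
      rw [add_sub_add_right_eq_sub] at this
      linarith
  have hgy : ‖gradient v y‖ = L := by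
    rw [norm_gradient_eq_norm_fderiv]
    exact norm_fderiv_eq_of_isMax hd hL.le hxy fun z => by linarith [hmax x z]
  have hgx : |‖gradient v x‖ - L| < η := by
    rw [← hgy, norm_gradient_eq_norm_fderiv, norm_gradient_eq_norm_fderiv]
    refine (abs_norm_sub_norm_le _ _).trans_lt
      ((norm_fderiv_sub_fderiv_le_of_isMax hd hε.le hdiag).trans_lt ?_)
    refine lt_of_pow_lt_pow_left₀ 2 hη.le ?_
    have : ε * ‖x‖ ^ 2 ≤ M := by linarith [hM x, hpos y]
    nlinarith
  have hHx : H ‖gradient v x‖ ≤ H L + c * σ / 4 := by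
    have := hHη (x := ‖gradient v x‖) (by rwa [Real.dist_eq])
    rw [Real.dist_eq] at this
    linarith [(abs_lt.1 this).2]
  have hlap := lap_sub_lap_le_of_isMax hv hdiag
  have hx := heq x
  have hy := heq y
  rw [hgy] at hy
  have hvx := hpos x
  have hvy := hpos y
  have h₁ : H ‖gradient v x‖ / v x ≤ H L / v x + c / 4 := by
    calc H ‖gradient v x‖ / v x ≤ (H L + c * σ / 4) / v x := by gcongr
      _ = H L / v x + c / 4 * (σ / v x) := by ring
      _ ≤ H L / v x + c / 4 * 1 := by
        gcongr
        rw [div_le_one hvx]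
        linarith
      _ = H L / v x + c / 4 := by ring
  have h₂ : c ≤ H L / v y - H L / v x := by
    have : H L / v y - H L / v x = H L * (v x - v y) / (v x * v y) := by
      field_simp
    rw [this, hc]
    have := hM x
    have := hM y
    have : v x * v y ≤ M ^ 2 := by nlinarith
    have : 0 ≤ H L * (v x - v y) := mul_nonneg hHL.le (by linarith)
    gcongr
  linarith

/-- The power `v = u^k`, `k = (q+p-1)/(p-2)`, of a solution of `-Δu = u^q |∇u|^p` solves an
equation whose right-hand side is a function of `|∇v|` divided by `v`. -/
theorem neg_lap_rpow_eq {n : ℕ} {p q k : ℝ} (hk : 0 < k) (hkeq : k * (p - 2) = q + p - 1)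
    {u : EuclideanSpace ℝ (Fin n) → ℝ} (hpos : ∀ x, 0 < u x) (hu : ContDiff ℝ 2 u)
    (heq : ∀ x, -lap u x = u x ^ q * ‖gradient u x‖ ^ p) (x : EuclideanSpace ℝ (Fin n)) :
    -lap (fun y => u y ^ k) x =
      (k ^ (1 - p) * ‖gradient (fun y => u y ^ k) x‖ ^ p -
        (1 - 1 / k) * ‖gradient (fun y => u y ^ k) x‖ ^ 2) / u x ^ k := by
  have hux := hpos x
  rw [lap_rpow hu hpos, norm_gradient_rpow (hu.differentiable (by norm_num)) hpos hk,
    show lap u x = -(u x ^ q * ‖gradient u x‖ ^ p) by linarith [heq x]]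
  set g := ‖gradient u x‖
  have hg0 : 0 ≤ g := norm_nonneg _
  have h₁ : k ^ (1 - p) * (k * u x ^ (k - 1) * g) ^ p =
      k * (u x ^ (k - 1) * u x ^ q * g ^ p) * u x ^ k := by
    rw [Real.mul_rpow (by positivity) hg0, Real.mul_rpow hk.le (by positivity),
      ← Real.rpow_mul hux.le]
    have h₂ : k ^ (1 - p) * k ^ p = k := by
      rw [← Real.rpow_add hk]
      simp
    have h₃ : u x ^ ((k - 1) * p) = u x ^ (k - 1) * u x ^ q * u x ^ k := by
      rw [← Real.rpow_add hux, ← Real.rpow_add hux]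
      congr 1
      linarith
    rw [h₃]
    linear_combination (u x ^ (k - 1) * u x ^ q * u x ^ k) * g ^ p * h₂
  have h₄ : (u x ^ (k - 1)) ^ 2 = u x ^ (k - 2) * u x ^ k := by
    rw [pow_two, ← Real.rpow_add hux, ← Real.rpow_add hux]
    congr 1
    ring
  rw [h₁, mul_pow, mul_pow, h₄]
  have : 0 < u x ^ k := by positivity
  field_simp
  ring

/-- **Bernstein gradient estimate** (final estimate in the proof of Lemma 2.1):
for `p > 2`, `q > 0` and `m = (p-2)/(q+p-1)`, there is a constant `C > 0` depending only
on `n, p, q` such that for every positive bounded classical solution `u` of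
`-Δu = u^q |∇u|^p` on `ℝⁿ`, the function `v = u^{1/m} = u^{(q+p-1)/(p-2)}` satisfies
`|∇v(x)| ≤ C(1 + ‖v‖_∞)` for all `x`; in particular `∇v` is bounded. -/
theorem bernstein_gradient_estimate {n : ℕ} (hn : 1 ≤ n) {p q : ℝ} (hp : 2 < p)
    (hq : 0 < q) :
    ∃ C : ℝ, 0 < C ∧
      ∀ u : EuclideanSpace ℝ (Fin n) → ℝ,
        (∀ x, 0 < u x) →
        (∃ M : ℝ, ∀ x, u x ≤ M) →
        ContDiff ℝ 2 u →
        (∀ x, -lap u x = u x ^ q * ‖gradient u x‖ ^ p) →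
        ∀ x, ‖gradient (fun y => u y ^ ((q + p - 1) / (p - 2))) x‖ ≤
          C * (1 + ⨆ y, u y ^ ((q + p - 1) / (p - 2))) := by
  have hp2 : 0 < p - 2 := by linarith
  set k : ℝ := (q + p - 1) / (p - 2) with hkdef
  have hk : 0 < k := div_pos (by linarith) hp2
  have hkeq : k * (p - 2) = q + p - 1 := div_mul_cancel₀ _ hp2.ne'
  set L : ℝ := k ^ ((p - 1) / (p - 2)) with hLdef
  have hL : 0 < L := by positivity
  refine ⟨L, hL, fun u hpos ⟨M, hM⟩ hu heq x => ?_⟩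
  have hHL : 0 < k ^ (1 - p) * L ^ p - (1 - 1 / k) * L ^ 2 := by
    have h₁ : L ^ p = k ^ (p - 1) * L ^ 2 := by
      have h₂ : L ^ (p - 2) = k ^ (p - 1) := by
        rw [hLdef, ← Real.rpow_mul hk.le, div_mul_cancel₀ _ hp2.ne']
      rw [← h₂, ← Real.rpow_natCast, ← Real.rpow_add hL]
      congr 1
      push_cast
      ring
    have h₃ : k ^ (1 - p) * k ^ (p - 1) = 1 := by
      rw [← Real.rpow_add hk]
      simp
    have h₄ : k ^ (1 - p) * L ^ p - (1 - 1 / k) * L ^ 2 = L ^ 2 / k := by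
      rw [h₁]
      linear_combination L ^ 2 * h₃
    rw [h₄]
    positivity
  have hcont : ContinuousAt (fun s : ℝ => k ^ (1 - p) * s ^ p - (1 - 1 / k) * s ^ 2) L := by
    have := Real.continuousAt_rpow_const L p (Or.inl hL.ne')
    fun_prop
  have hsub := sub_le_mul_norm_sub_of_lap_eq (hu.rpow_const_of_ne fun y => (hpos y).ne')
    (fun y => Real.rpow_pos_of_pos (hpos y) k)
    (fun y => Real.rpow_le_rpow (hpos y).le (hM y) hk.le) hcont hL hHL
    (neg_lap_rpow_eq hk hkeq hpos hu heq)
  have hlip : LipschitzWith L.toNNReal fun y => u y ^ k :=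
    LipschitzWith.of_le_add_mul' L fun a b => by
      rw [dist_comm, dist_eq_norm]
      linarith [hsub a b]
  have hgrad : ‖gradient (fun y => u y ^ k) x‖ ≤ L := by
    rw [norm_gradient_eq_norm_fderiv]
    simpa [hL.le] using norm_fderiv_le_of_lipschitz ℝ (x₀ := x) hlip
  have hsup : 0 ≤ ⨆ y, u y ^ k := Real.iSup_nonneg fun y => (Real.rpow_pos_of_pos (hpos y) k).le
  nlinarith
end
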